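/- The Lebesgue integral over ℝ of the complex-valued function x ↦ x(x − 3i)(3x² − 1)/((x−i)⁶(x+i)³) equals πi/16. -/

import Mathlib

open Real Complex MeasureTheory

open Filter Topology

theorem ofReal_sub_I_ne_zero (x : ℝ) : (x : ℂ) - I ≠ 0 := fun h => by
  simpa using congrArg Complex.im h

theorem ofReal_add_I_ne_zero (x : ℝ) : (x : ℂ) + I ≠ 0 := fun h => by
  simpa using congrArg Complex.im h

theorem norm_ofReal_sub_I_sq (x : ℝ) : ‖(x : ℂ) - I‖ ^ 2 = 1 + x ^ 2 := by
  rw [← Complex.normSq_eq_norm_sq, Complex.normSq_apply]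
  simp
  ring

theorem norm_ofReal_add_I_eq_norm_sub (x : ℝ) : ‖(x : ℂ) + I‖ = ‖(x : ℂ) - I‖ := by
  rw [← Complex.norm_conj]
  simp [sub_eq_add_neg]

theorem tendsto_inv_ofReal_add_cobounded (c : ℂ) :
    Tendsto (fun x : ℝ => ((x : ℂ) + c)⁻¹) (Bornology.cobounded ℝ) (𝓝 0) := by
  refine tendsto_inv₀_cobounded.comp ?_
  rw [← tendsto_norm_atTop_iff_cobounded]
  refine tendsto_atTop_mono (f := fun x : ℝ => ‖x‖ + -‖c‖) (fun x => ?_)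
    (tendsto_atTop_add_const_right _ _ tendsto_norm_cobounded_atTop)
  have := norm_sub_le ((x : ℂ) + c) c
  rw [add_sub_cancel_right, Complex.norm_real] at this
  linarith

theorem hasDerivAt_inv_ofReal_add {c : ℂ} {x : ℝ} (h : (x : ℂ) + c ≠ 0) :
    HasDerivAt (fun x : ℝ => ((x : ℂ) + c)⁻¹) (-(((x : ℂ) + c)⁻¹) ^ 2) x := by
  have := (((hasDerivAt_id x).ofReal_comp).add_const c).inv h
  refine this.congr_deriv ?_
  simp [neg_div]

theorem integrable_phi5_b :
    Integrable fun x : ℝ => (((x : ℂ) * ((x : ℂ) - 3 * I) * (3 * (x : ℂ) ^ 2 - 1))) /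
      (((x : ℂ) - I) ^ 6 * ((x : ℂ) + I) ^ 3) := by
  refine (integrable_inv_one_add_sq.const_mul 9).mono' ?_ (ae_of_all _ fun x => ?_)
  · refine Continuous.aestronglyMeasurable (Continuous.div (by fun_prop) (by fun_prop) fun x => ?_)
    exact mul_ne_zero (pow_ne_zero _ (ofReal_sub_I_ne_zero x))
      (pow_ne_zero _ (ofReal_add_I_ne_zero x))
  · have hr := norm_ofReal_sub_I_sq x
    rw [norm_div, norm_mul, norm_mul, norm_mul, norm_pow, norm_pow,
      norm_ofReal_add_I_eq_norm_sub, ← hr, Complex.norm_real, Real.norm_eq_abs]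
    have h3 : ‖(x : ℂ) - 3 * I‖ ≤ ‖(x : ℂ) - I‖ + 2 := by
      have := norm_sub_le ((x : ℂ) - I) (2 * I)
      rw [show (x : ℂ) - I - 2 * I = x - 3 * I by ring] at this
      simpa using this
    have h4 : ‖3 * (x : ℂ) ^ 2 - 1‖ ≤ 3 * (1 + x ^ 2) := by
      rw [show 3 * (x : ℂ) ^ 2 - 1 = ((3 * x ^ 2 - 1 : ℝ) : ℂ) by push_cast; ring,
        Complex.norm_real, Real.norm_eq_abs, abs_le]
      constructor <;> nlinarith [sq_nonneg x]
    rw [← hr] at h4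
    set r := ‖(x : ℂ) - I‖
    have hr0 : 0 ≤ r := norm_nonneg _
    have hr1 : 1 ≤ r := by nlinarith [sq_nonneg x]
    have hx : |x| ≤ r := abs_le_of_sq_le_sq (by linarith) hr0
    have hnum : |x| * ‖(x : ℂ) - 3 * I‖ * ‖3 * (x : ℂ) ^ 2 - 1‖ ≤ r * (3 * r) * (3 * r ^ 2) := by
      gcongr
      linarith
    rw [← div_eq_mul_inv, div_le_div_iff₀ (by positivity) (by positivity)]
    calc _ ≤ r * (3 * r) * (3 * r ^ 2) * r ^ 2 := by gcongr
      _ = 9 * r ^ 6 := by ring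
      _ ≤ 9 * r ^ 9 := by gcongr; norm_num
      _ = _ := by ring

/-- The rational part of a primitive of the integrand, as a polynomial in
`u = (x - i)⁻¹` and `v = (x + i)⁻¹`. -/
noncomputable def phi5RationalPart (u v : ℂ) : ℂ :=
  I / 5 * u ^ 5 + 1 / 8 * u ^ 4 + I / 6 * u ^ 3 + 1 / 16 * u ^ 2 + I / 8 * u
    + 1 / 8 * v ^ 2 - I / 16 * v

theorem hasDerivAt_phi5_primitive (x : ℝ) :
    HasDerivAt (fun x : ℝ => I / 16 * (Real.arctan x : ℂ) +
        phi5RationalPart ((x : ℂ) + -I)⁻¹ ((x : ℂ) + I)⁻¹)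
      ((((x : ℂ) * ((x : ℂ) - 3 * I) * (3 * (x : ℂ) ^ 2 - 1))) /
        (((x : ℂ) - I) ^ 6 * ((x : ℂ) + I) ^ 3)) x := by
  have hm := ofReal_sub_I_ne_zero x
  have hp := ofReal_add_I_ne_zero x
  have hu := hasDerivAt_inv_ofReal_add (c := -I) (x := x) (by rwa [← sub_eq_add_neg])
  have hv := hasDerivAt_inv_ofReal_add hp
  have ha := (Real.hasDerivAt_arctan x).ofReal_comp
  have hF := (ha.const_mul (I / 16)).add
    ((((((((hu.pow 5).const_mul (I / 5)).add ((hu.pow 4).const_mul (1 / 8))).add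
      ((hu.pow 3).const_mul (I / 6))).add ((hu.pow 2).const_mul (1 / 16))).add
      (hu.const_mul (I / 8))).add ((hv.pow 2).const_mul (1 / 8))).sub (hv.const_mul (I / 16)))
  refine (hF.congr_of_eventuallyEq (Eventually.of_forall fun y => ?_)).congr_deriv ?_
  · simp [phi5RationalPart]
  have hq : (1 : ℂ) + (x : ℂ) ^ 2 = (x - I) * (x + I) := by
    linear_combination Complex.I_sq
  push_cast
  rw [hq, ← sub_eq_add_neg]
  obtain ⟨y, hy⟩ : ∃ y, y = (x : ℂ) - I := ⟨_, rfl⟩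
  have hx : (x : ℂ) = y + I := by rw [hy]; ring
  rw [hx] at hm hp ⊢
  rw [add_sub_cancel_right] at hm ⊢
  field_simp
  ring_nf
  simp only [show I ^ 3 = -I by rw [pow_succ, I_sq]; ring, I_sq, I_pow_four]
  ring

theorem tendsto_phi5_primitive {l : Filter ℝ} {a : ℝ} (hl : l ≤ Bornology.cobounded ℝ)
    (ha : Tendsto Real.arctan l (𝓝 a)) :
    Tendsto (fun x : ℝ => I / 16 * (Real.arctan x : ℂ) +
      phi5RationalPart ((x : ℂ) + -I)⁻¹ ((x : ℂ) + I)⁻¹) l (𝓝 (I / 16 * (a : ℂ))) := by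
  have hu := (tendsto_inv_ofReal_add_cobounded (-I)).mono_left hl
  have hv := (tendsto_inv_ofReal_add_cobounded I).mono_left hl
  have hc : Continuous fun p : ℂ × ℂ × ℂ => I / 16 * p.1 + phi5RationalPart p.2.1 p.2.2 := by
    unfold phi5RationalPart
    fun_prop
  have := (hc.tendsto ((a : ℂ), 0, 0)).comp
    (((continuous_ofReal.tendsto a).comp ha).prodMk_nhds (hu.prodMk_nhds hv))
  simpa [phi5RationalPart, Function.comp_def] using this

theorem integral_phi5_b :
    ∫ x : ℝ, (((x : ℂ) * ((x : ℂ) - 3 * I) * (3 * (x : ℂ) ^ 2 - 1))) / (((x : ℂ) - I) ^ 6 * ((x : ℂ) + I) ^ 3) = (π : ℂ) * I / 16 := by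
  rw [integral_of_hasDerivAt_of_tendsto hasDerivAt_phi5_primitive integrable_phi5_b
    (tendsto_phi5_primitive IsOrderBornology.atBot_le_cobounded
      (Real.tendsto_arctan_atBot.mono_right nhdsWithin_le_nhds))
    (tendsto_phi5_primitive IsOrderBornology.atTop_le_cobounded
      (Real.tendsto_arctan_atTop.mono_right nhdsWithin_le_nhds))]
  push_cast
  ring
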